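/- Let k be an algebraically closed field and X a generating pattern on [n]. Let σ_1,…,σ_s be edges of the GCD graph G_X (two-element subsets whose elements are adjacent) and set θ = σ_1 ∪ ⋯ ∪ σ_s. Suppose that: N(θ) = [n]; N(σ_i) ∩ N(σ_j) = ∅ for all i ≠ j; and for every i and every ℓ ∈ N(σ_i) ∖ σ_i, the set N({ℓ}) is not contained in N(σ_i). Then V_X = k^n. -/

import Mathlib

open scoped Classical

noncomputable section

/-- A *generating pattern* on `[n]`: a finite set `X` of nonempty subsets of `Fin n`
such that for all `i ≠ j` there is `σ ∈ X` with `i ∈ σ` and `j ∉ σ`. -/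
def IsGenPattern (n : ℕ) (X : Finset (Finset (Fin n))) : Prop :=
  (∀ σ ∈ X, σ.Nonempty) ∧ ∀ i j : Fin n, i ≠ j → ∃ σ ∈ X, i ∈ σ ∧ j ∉ σ

/-- Adjacency in the GCD graph of a generating pattern. -/
def GcdAdj {n : ℕ} (X : Finset (Finset (Fin n))) (i j : Fin n) : Prop :=
  i ≠ j ∧ ∃ σ ∈ X, i ∈ σ ∧ j ∈ σ

/-- The neighborhood of a set of vertices in the GCD graph. -/
def Nbhd {n : ℕ} (X : Finset (Finset (Fin n))) (S : Finset (Fin n)) : Finset (Fin n) :=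
  Finset.univ.filter fun j => ∃ i ∈ S, GcdAdj X i j

/-- The differential edge `d_{σ,i}` (from `σ ∪ {i}` to `σ`) exists. -/
def DiffEdge {n : ℕ} (X : Finset (Finset (Fin n))) (σ : Finset (Fin n)) (i : Fin n) : Prop :=
  i ∉ σ ∧ ∀ τ ∈ X, i ∈ τ → (τ ∩ σ).Nonempty

/-- The homotopy edge `h_{σ,i}` (from `σ` to `σ ∪ {i}`) exists. -/
def HomEdge {n : ℕ} (X : Finset (Finset (Fin n))) (σ : Finset (Fin n)) (i : Fin n) : Prop :=
  i ∉ σ ∧ i ∉ Nbhd X σ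

/-- `sign(σ, i) = (-1)^{|{j ∈ σ : j < i}|}`. -/
def edgeSign {n : ℕ} (σ : Finset (Fin n)) (i : Fin n) : ℤ :=
  (-1) ^ (σ.filter fun j => j < i).card

/-- The Taylor matrix of the generating pattern `X`, evaluated at the point `a : Fin n → k`. -/
def taylorMatrixAt {n : ℕ} {k : Type*} [Field k] (X : Finset (Finset (Fin n)))
    (a : Fin n → k) : Matrix (Finset (Fin n)) (Finset (Fin n)) k :=
  fun r c =>
    (∑ i : Fin n, if c = insert i r ∧ DiffEdge X r i then (edgeSign r i : k) else 0) +
      ∑ i : Fin n, if r = insert i c ∧ HomEdge X c i then (edgeSign c i : k) * a i else 0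

/-- The cohomological support variety `V_X ⊆ k^n`: the locus where all
`2^(n-1) × 2^(n-1)` minors of the Taylor matrix vanish. -/
def supportVariety {n : ℕ} (k : Type*) [Field k] (X : Finset (Finset (Fin n))) :
    Set (Fin n → k) :=
  { a | ∀ f g : Fin (2 ^ (n - 1)) → Finset (Fin n),
      Function.Injective f → Function.Injective g →
      ((taylorMatrixAt X a).submatrix f g).det = 0 }

def tog {n : ℕ} (i : Fin n) (r : Finset (Fin n)) : Finset (Fin n) :=
  if i ∈ r then r.erase i else insert i r

lemma mem_tog {n : ℕ} (i x : Fin n) (r : Finset (Fin n)) :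
    x ∈ tog i r ↔ ((x = i ∧ x ∉ r) ∨ (x ≠ i ∧ x ∈ r)) := by
  unfold tog; split_ifs <;> simp <;> grind

lemma tog_comm {n : ℕ} (i j : Fin n) (r : Finset (Fin n)) :
    tog i (tog j r) = tog j (tog i r) := by
  ext x; simp only [mem_tog]; grind

def TE {n : ℕ} (X : Finset (Finset (Fin n))) (i : Fin n) (r : Finset (Fin n)) : Prop :=
  (i ∈ r → ∀ m ∈ r, m ≠ i → ∀ τ ∈ X, m ∈ τ → i ∉ τ) ∧
  (i ∉ r → ∀ τ ∈ X, i ∈ τ → ∃ m ∈ τ, m ∈ r)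

lemma TE_mem {n : ℕ} (X : Finset (Finset (Fin n))) (i : Fin n) (r : Finset (Fin n))
    (h : i ∈ r) : TE X i r ↔ HomEdge X (r.erase i) i := by
  simp only [TE, HomEdge, Nbhd, GcdAdj, Finset.mem_filter, Finset.mem_univ, Finset.mem_erase]
  grind

lemma TE_not_mem {n : ℕ} (X : Finset (Finset (Fin n))) (i : Fin n) (r : Finset (Fin n))
    (h : i ∉ r) : TE X i r ↔ DiffEdge X r i := by
  simp only [TE, DiffEdge, Finset.Nonempty, Finset.mem_inter]
  grind

lemma TE_imp {n : ℕ} (X : Finset (Finset (Fin n))) (i j : Fin n) (hij : i ≠ j)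
    (r : Finset (Fin n)) (h1 : TE X i r) (h2 : TE X j (tog i r)) :
    TE X j r ∧ TE X i (tog j r) := by
  simp only [TE, mem_tog] at *
  by_cases hi : i ∈ r <;> by_cases hj : j ∈ r <;> simp [hi, hj, hij, hij.symm] at h1 h2 ⊢ <;> grind

lemma TE_self {n : ℕ} (X : Finset (Finset (Fin n))) (i : Fin n)
    (r : Finset (Fin n)) (hi : ∃ τ ∈ X, i ∈ τ) (h1 : TE X i r) (h2 : TE X i (tog i r)) :
    False := by
  obtain ⟨τ, hτ, hiτ⟩ := hi
  simp only [TE, mem_tog] at *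
  by_cases hi : i ∈ r <;> simp [hi] at h1 h2 <;> grind

lemma sign_lt {n : ℕ} (i j : Fin n) (hij : i < j) (r : Finset (Fin n)) :
    edgeSign (tog j r) i = edgeSign r i ∧ edgeSign (tog i r) j = - edgeSign r j := by
  constructor
  · unfold edgeSign
    congr 2
    ext x; simp only [Finset.mem_filter, mem_tog]; grind
  · unfold edgeSign
    by_cases h : i ∈ r
    · have : r.filter (fun x => x < j) = insert i ((tog i r).filter (fun x => x < j)) := by
        ext x; simp only [Finset.mem_filter, mem_tog, Finset.mem_insert]; grind
      rw [this, Finset.card_insert_of_notMem (by simp [mem_tog, h]), pow_succ]; ring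
    · have : (tog i r).filter (fun x => x < j) = insert i (r.filter (fun x => x < j)) := by
        ext x; simp only [Finset.mem_filter, mem_tog, Finset.mem_insert]; grind
      rw [this, Finset.card_insert_of_notMem (by simp [h]), pow_succ]; ring

lemma sign_anti {n : ℕ} (i j : Fin n) (hij : i ≠ j) (r : Finset (Fin n)) :
    edgeSign r i * edgeSign (tog i r) j = - (edgeSign r j * edgeSign (tog j r) i) := by
  rcases lt_or_gt_of_ne hij with h | h
  · rw [(sign_lt i j h r).1, (sign_lt i j h r).2]; ring
  · rw [(sign_lt j i h r).1, (sign_lt j i h r).2]; ring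

def TC {n : ℕ} {k : Type*} [Field k] (X : Finset (Finset (Fin n))) (a : Fin n → k)
    (i : Fin n) (r : Finset (Fin n)) : k :=
  if TE X i r then (edgeSign r i : k) * (if i ∈ r then a i else 1) else 0

lemma TC_anti {n : ℕ} {k : Type*} [Field k] (X : Finset (Finset (Fin n))) (a : Fin n → k)
    (i j : Fin n) (hij : i ≠ j) (r : Finset (Fin n)) :
    TC X a i r * TC X a j (tog i r) + TC X a j r * TC X a i (tog j r) = 0 := by
  have hs : (edgeSign r i : k) * (edgeSign (tog i r) j : k)
      = - ((edgeSign r j : k) * (edgeSign (tog j r) i : k)) := by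
    exact_mod_cast congrArg (Int.cast : ℤ → k) (sign_anti i j hij r)
  have m1 : (j ∈ tog i r) = (j ∈ r) := by simp [mem_tog, hij.symm]
  have m2 : (i ∈ tog j r) = (i ∈ r) := by simp [mem_tog, hij]
  by_cases h : TE X i r ∧ TE X j (tog i r)
  · obtain ⟨h3, h4⟩ := TE_imp X i j hij r h.1 h.2
    simp only [TC, h.1, h.2, h3, h4, m1, m2, if_true]
    linear_combination (if i ∈ r then a i else 1) * (if j ∈ r then a j else 1) * hs
  · have h' : ¬ (TE X j r ∧ TE X i (tog j r)) := fun h' => h (TE_imp X j i hij.symm r h'.1 h'.2)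
    have e1 : TC X a i r * TC X a j (tog i r) = 0 := by
      unfold TC; split_ifs <;> simp_all
    have e2 : TC X a j r * TC X a i (tog j r) = 0 := by
      unfold TC; split_ifs <;> simp_all
    rw [e1, e2, add_zero]

lemma taylor_eq {n : ℕ} {k : Type*} [Field k] (X : Finset (Finset (Fin n))) (a : Fin n → k)
    (r c : Finset (Fin n)) :
    taylorMatrixAt X a r c = ∑ i, if c = tog i r then TC X a i r else 0 := by
  unfold taylorMatrixAt
  rw [← Finset.sum_add_distrib]
  refine Finset.sum_congr rfl fun i _ => ?_
  by_cases h : i ∈ r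
  · have hd : ¬ DiffEdge X r i := fun hd => hd.1 h
    have ht : tog i r = r.erase i := by simp [tog, h]
    have hc : (r = insert i c ∧ HomEdge X c i) ↔
        (c = r.erase i ∧ HomEdge X (r.erase i) i) := by
      constructor
      · rintro ⟨h1, h2⟩
        have : c = r.erase i := by rw [h1, Finset.erase_insert h2.1]
        exact ⟨this, this ▸ h2⟩
      · rintro ⟨h1, h2⟩
        exact ⟨by rw [h1, Finset.insert_erase h], h1 ▸ h2⟩
    have hs : c = r.erase i → edgeSign c i = edgeSign r i := by
      rintro rfl
      unfold edgeSign
      congr 2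
      ext x; simp only [Finset.mem_filter, Finset.mem_erase]; grind
    simp only [hd, and_false, if_false, zero_add, hc, ht, TC, TE_mem X i r h, h, if_true]
    by_cases h1 : c = r.erase i
    · simp [h1, ← hs h1]
    · simp [h1]
  · have hc : ¬ (r = insert i c ∧ HomEdge X c i) := by
      rintro ⟨h1, -⟩; exact h (h1 ▸ Finset.mem_insert_self _ _)
    have ht : tog i r = insert i r := by simp [tog, h]
    simp only [hc, if_false, add_zero, ht, TC, TE_not_mem X i r h, h, mul_one, ite_and]

lemma taylor_mulVec {n : ℕ} {k : Type*} [Field k] (X : Finset (Finset (Fin n))) (a : Fin n → k)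
    (v : Finset (Fin n) → k) (r : Finset (Fin n)) :
    (taylorMatrixAt X a).mulVec v r = ∑ i, TC X a i r * v (tog i r) := by
  simp only [Matrix.mulVec, dotProduct, taylor_eq, Finset.sum_mul]
  rw [Finset.sum_comm]
  refine Finset.sum_congr rfl fun i _ => ?_
  simp [ite_mul]

lemma taylor_sq {n : ℕ} {k : Type*} [Field k] (X : Finset (Finset (Fin n))) (a : Fin n → k)
    (hX : ∀ i : Fin n, ∃ τ ∈ X, i ∈ τ) (v : Finset (Fin n) → k) :
    (taylorMatrixAt X a).mulVec ((taylorMatrixAt X a).mulVec v) = 0 := by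
  funext r
  simp only [taylor_mulVec, Finset.mul_sum, Pi.zero_apply]
  rw [← Finset.sum_product']
  have hself : ∀ i, TC X a i r * TC X a i (tog i r) = 0 := by
    intro i
    by_cases h1 : TE X i r
    · have h2 : ¬ TE X i (tog i r) := fun h2 => TE_self X i r (hX i) h1 h2
      simp [TC, h2]
    · simp [TC, h1]
  refine Finset.sum_involution (fun x _ => (x.2, x.1)) ?_ ?_ ?_ ?_
  · rintro ⟨i, j⟩ _
    by_cases hij : i = j
    · subst hij
      simp only [← mul_assoc, hself]; simp
    · have := TC_anti X a i j hij r
      simp only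
      rw [tog_comm j i r]
      linear_combination v (tog i (tog j r)) * this
  · rintro ⟨i, j⟩ _ hne h
    simp only [Prod.mk.injEq] at h
    obtain ⟨rfl, -⟩ := h
    exact hne (by simp only [← mul_assoc, hself, zero_mul])
  · simp
  · simp

lemma full_of_isolated {n : ℕ} {k : Type*} [Field k] (X : Finset (Finset (Fin n)))
    (hX : ∀ i : Fin n, ∃ τ ∈ X, i ∈ τ) (θ : Finset (Fin n))
    (h1 : ∀ i, ¬ TE X i θ) (h2 : ∀ i, ¬ TE X i (tog i θ)) :
    supportVariety k X = Set.univ := by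
  ext a
  simp only [Set.mem_univ, iff_true]
  intro f g _ _
  by_contra hdet
  set T := taylorMatrixAt X a with hT
  have hrk : 2 ^ (n - 1) ≤ T.rank := by
    have := Matrix.rank_of_isUnit (T.submatrix f g)
      ((Matrix.isUnit_iff_isUnit_det _).2 (isUnit_iff_ne_zero.2 hdet))
    have h3 := Matrix.rank_submatrix_le T f g
    simp at this; omega
  have hlt : LinearMap.range T.mulVecLin < LinearMap.ker T.mulVecLin := by
    refine lt_of_le_of_ne ?_ ?_
    · rintro _ ⟨v, rfl⟩
      exact taylor_sq X a hX v
    · intro he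
      have hm : (Pi.single θ 1 : Finset (Fin n) → k) ∈ LinearMap.ker T.mulVecLin := by
        rw [LinearMap.mem_ker, Matrix.mulVecLin_apply]
        funext r
        rw [hT, taylor_mulVec]
        refine Finset.sum_eq_zero fun i _ => ?_
        by_cases h : tog i r = θ
        · have : r = tog i θ := by
            rw [← h]; ext x; simp only [mem_tog]; grind
          simp [TC, this, h2 i]
        · simp [h]
      rw [← he] at hm
      obtain ⟨v, hv⟩ := hm
      have := congrFun hv θ
      rw [Matrix.mulVecLin_apply, hT, taylor_mulVec] at this
      simp [TC, h1] at this
  have h4 := Submodule.finrank_lt_finrank_of_lt hlt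
  have h5 := T.mulVecLin.finrank_range_add_finrank_ker
  have h6 : T.rank = Module.finrank k (LinearMap.range T.mulVecLin) := rfl
  simp at h5
  cases n with
  | zero => simp at *; omega
  | succ m => simp [pow_succ] at *; omega

/-- A family of edges of the GCD graph with `N(θ) = [n]`, pairwise disjoint
neighborhoods, and no vertex of `N(σ_i) ∖ σ_i` having its whole neighborhood inside
`N(σ_i)`, forces full support. -/
theorem edges_with_disjoint_neighborhoods_full_support (n : ℕ) (k : Type*)
    [Field k] [IsAlgClosed k]
    (X : Finset (Finset (Fin n))) (hX : IsGenPattern n X)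
    (s : ℕ) (σ : Fin s → Finset (Fin n))
    (hedge : ∀ t : Fin s, ∃ i j : Fin n, GcdAdj X i j ∧ σ t = ({i, j} : Finset (Fin n)))
    (hN : Nbhd X (Finset.univ.biUnion σ) = Finset.univ)
    (hdisj : ∀ t t' : Fin s, t ≠ t' → Nbhd X (σ t) ∩ Nbhd X (σ t') = ∅)
    (hnbr : ∀ t : Fin s, ∀ l ∈ Nbhd X (σ t) \ σ t, ¬ (Nbhd X {l} ⊆ Nbhd X (σ t))) :
    supportVariety k X = Set.univ := by
  have hθ : ∀ x, ∃ t, x ∈ Nbhd X (σ t) := by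
    intro x
    have := Finset.mem_univ x
    rw [← hN] at this
    simp only [Nbhd, Finset.mem_filter, Finset.mem_biUnion, Finset.mem_univ, true_and] at this ⊢
    grind
  have huniq : ∀ x t t', x ∈ Nbhd X (σ t) → x ∈ Nbhd X (σ t') → t = t' := by
    intro x t t' h h'
    by_contra hne
    have : x ∈ Nbhd X (σ t) ∩ Nbhd X (σ t') := Finset.mem_inter.2 ⟨h, h'⟩
    rw [hdisj t t' hne] at this
    simp at this
  have hmem : ∀ x t, x ∈ Nbhd X (σ t) ↔ ∃ i ∈ σ t, i ≠ x ∧ ∃ τ ∈ X, i ∈ τ ∧ x ∈ τ := by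
    intro x t; unfold Nbhd; rw [Finset.mem_filter]; simp only [GcdAdj, Finset.mem_univ, true_and]
  have hsub : ∀ t, ∀ x ∈ σ t, x ∈ Nbhd X (σ t) := by
    intro t x hx
    obtain ⟨i, j, ⟨hij, τ, hτ, hi, hj⟩, hs⟩ := hedge t
    rw [hmem]
    rw [hs] at hx ⊢
    simp only [Finset.mem_insert, Finset.mem_singleton] at hx ⊢
    grind
  have hmθ : ∀ x, x ∈ Finset.univ.biUnion σ ↔ ∃ t, x ∈ σ t := by simp
  have hsolo : ∀ t, ∀ x ∈ σ t, ∃ y ∈ σ t, y ≠ x ∧ (∃ τ ∈ X, x ∈ τ ∧ y ∈ τ) ∧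
      ∃ τ ∈ X, x ∈ τ ∧ ∀ z ∈ τ, z ≠ x → ∀ t', z ∉ σ t' := by
    intro t x hx
    obtain ⟨y, hy, hyx, hadj, hall⟩ : ∃ y ∈ σ t, y ≠ x ∧ (∃ τ ∈ X, x ∈ τ ∧ y ∈ τ) ∧
        ∀ z ∈ σ t, z = x ∨ z = y := by
      obtain ⟨i, j, ⟨hij, τ, hτ, hi, hj⟩, hs⟩ := hedge t
      rw [hs] at hx ⊢
      simp only [Finset.mem_insert, Finset.mem_singleton] at hx ⊢
      rcases hx with rfl | rfl
      · exact ⟨j, Or.inr rfl, hij.symm, ⟨τ, hτ, hi, hj⟩, fun z h => h⟩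
      · exact ⟨i, Or.inl rfl, hij, ⟨τ, hτ, hj, hi⟩, fun z h => h.symm⟩
    obtain ⟨τ, hτ, hxτ, hyτ⟩ := hX.2 x y hyx.symm
    refine ⟨y, hy, hyx, hadj, τ, hτ, hxτ, ?_⟩
    intro z hz hzx t' hzt
    have hz1 : z ∈ Nbhd X (σ t) := (hmem z t).2 ⟨x, hx, hzx.symm, τ, hτ, hxτ, hz⟩
    have := huniq z t t' hz1 (hsub t' z hzt)
    subst this
    rcases hall z hzt with rfl | rfl
    · exact hzx rfl
    · exact hyτ hz
  have hout : ∀ l, (∀ t, l ∉ σ t) → ∃ τ ∈ X, l ∈ τ ∧ ∀ z ∈ τ, ∀ t, z ∉ σ t := by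
    intro l hl
    obtain ⟨t, ht⟩ := hθ l
    have := hnbr t l (Finset.mem_sdiff.2 ⟨ht, hl t⟩)
    rw [Finset.not_subset] at this
    obtain ⟨m, hm, hmt⟩ := this
    simp only [Nbhd, GcdAdj, Finset.mem_filter, Finset.mem_univ, true_and,
      Finset.mem_singleton, exists_eq_left] at hm
    obtain ⟨hlm, τ, hτ, hlτ, hmτ⟩ := hm
    refine ⟨τ, hτ, hlτ, ?_⟩
    intro p hp t' hpt
    have hlp : p ≠ l := fun h => hl t' (h ▸ hpt)
    have hl' : l ∈ Nbhd X (σ t') := (hmem l t').2 ⟨p, hpt, hlp, τ, hτ, hp, hlτ⟩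
    have := huniq l t t' ht hl'
    subst this
    by_cases hpm : p = m
    · exact hmt (hpm ▸ hsub t p hpt)
    · exact hmt ((hmem m t).2 ⟨p, hpt, hpm, τ, hτ, hp, hmτ⟩)
  refine full_of_isolated X ?_ (Finset.univ.biUnion σ) ?_ ?_
  · intro x
    obtain ⟨t, ht⟩ := hθ x
    obtain ⟨i, -, -, τ, hτ, -, h⟩ := (hmem x t).1 ht
    exact ⟨τ, hτ, h⟩
  · rintro x ⟨ha, hb⟩
    by_cases hx : x ∈ Finset.univ.biUnion σ
    · obtain ⟨t, ht⟩ := (hmθ x).1 hx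
      obtain ⟨y, hy, hyx, ⟨τ, hτ, hxτ, hyτ⟩, -⟩ := hsolo t x ht
      exact ha hx y ((hmθ y).2 ⟨t, hy⟩) hyx τ hτ hyτ hxτ
    · obtain ⟨τ, hτ, hxτ, h⟩ := hout x (fun t ht => hx ((hmθ x).2 ⟨t, ht⟩))
      obtain ⟨m, hm, hm'⟩ := hb hx τ hτ hxτ
      obtain ⟨t, ht⟩ := (hmθ m).1 hm'
      exact h m hm t ht
  · rintro x ⟨ha, hb⟩
    simp only [mem_tog] at ha hb
    by_cases hx : x ∈ Finset.univ.biUnion σ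
    · obtain ⟨t, ht⟩ := (hmθ x).1 hx
      obtain ⟨y, hy, hyx, -, τ, hτ, hxτ, h⟩ := hsolo t x ht
      obtain ⟨m, hm, hm'⟩ := hb (by tauto) τ hτ hxτ
      rcases hm' with ⟨rfl, h'⟩ | ⟨hmx, h'⟩
      · exact h' hx
      · obtain ⟨t', ht'⟩ := (hmθ m).1 h'
        exact h m hm hmx t' ht'
    · obtain ⟨t, ht⟩ := hθ x
      obtain ⟨i, hi, hix, τ, hτ, hiτ, hxτ⟩ := (hmem x t).1 ht
      exact ha (by tauto) i (Or.inr ⟨hix, (hmθ i).2 ⟨t, hi⟩⟩) hix τ hτ hiτ hxτ
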